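/- arXiv:2307.02193 — 2 statements merged into one kernel-verified Lean document; each statement's English description precedes it below -/
import Mathlib

section
/- Let f : [m]^n → ℝ satisfy |f(x) − f(y)| ≤ L·‖x − y‖₁ for all x, y ∈ [m]^n, and suppose d₁(f) > ε, where d₁(f) is the L¹ distance from f to the set of monotone functions under the uniform measure on [m]^n. For each i ∈ [n] let S_i := {x ∈ [m]^n : ∂_i f(x) < 0}. Then Σ_{i=1}^n μ(S_i) > ε/(2mL), where μ is the uniform probability measure on [m]^n. -/
/-- The discrete partial derivative `∂ᵢ f(x) = f(x + eᵢ) − f(x)` if `xᵢ < m`, and `0`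
if `xᵢ = m`. -/
noncomputable def dPartial {m n : ℕ} (i : Fin n) (f : (Fin n → Fin m) → ℝ)
    (x : Fin n → Fin m) : ℝ :=
  if h : (x i : ℕ) + 1 < m then f (Function.update x i ⟨(x i : ℕ) + 1, h⟩) - f x else 0

open Finset

/-- The values of `h` listed in nondecreasing order. -/
noncomputable def sortedTuple {m : ℕ} (h : Fin m → ℝ) : Fin m → ℝ := h ∘ Tuple.sort h

lemma sortedTuple_monotone {m : ℕ} (h : Fin m → ℝ) : Monotone (sortedTuple h) :=
  Tuple.monotone_sort h

lemma sum_sortedTuple {m : ℕ} (h : Fin m → ℝ) : ∑ a, sortedTuple h a = ∑ a, h a :=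
  Equiv.sum_comp (Tuple.sort h) h

lemma sortedTuple_le_of_card {m : ℕ} {h : Fin m → ℝ} {k : Fin m} {c : ℝ} {s : Finset (Fin m)}
    (hs : (k : ℕ) < #s) (hc : ∀ j ∈ s, h j ≤ c) : sortedTuple h k ≤ c := by
  by_contra! hlt
  have hsub : s ⊆ (Iio k).map (Tuple.sort h).toEmbedding := by
    intro j hj
    refine mem_map.2 ⟨(Tuple.sort h).symm j, mem_Iio.2 ?_, by simp⟩
    by_contra! hk
    have := sortedTuple_monotone h hk
    simp only [sortedTuple, Function.comp_apply, Equiv.apply_symm_apply] at this hlt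
    linarith [hc j hj]
  have := card_le_card hsub
  simp at this
  omega

lemma le_sortedTuple_of_card {m : ℕ} {h : Fin m → ℝ} {k : Fin m} {c : ℝ} {s : Finset (Fin m)}
    (hs : m - 1 - (k : ℕ) < #s) (hc : ∀ j ∈ s, c ≤ h j) : c ≤ sortedTuple h k := by
  by_contra! hlt
  have hsub : s ⊆ (Ioi k).map (Tuple.sort h).toEmbedding := by
    intro j hj
    refine mem_map.2 ⟨(Tuple.sort h).symm j, mem_Ioi.2 ?_, by simp⟩
    by_contra! hk
    have := sortedTuple_monotone h hk
    simp only [sortedTuple, Function.comp_apply, Equiv.apply_symm_apply] at this hlt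
    linarith [hc j hj]
  have := card_le_card hsub
  simp at this
  omega

lemma sortedTuple_mono {m : ℕ} {u v : Fin m → ℝ} (huv : u ≤ v) :
    sortedTuple u ≤ sortedTuple v := by
  intro k
  refine sortedTuple_le_of_card (s := (Iic k).map (Tuple.sort v).toEmbedding) (by simp) ?_
  intro j hj
  obtain ⟨a, ha, rfl⟩ := mem_map.1 hj
  exact (huv _).trans (sortedTuple_monotone v (mem_Iic.1 ha))

/-- Sorting, being order preserving and sum preserving, is a contraction for the sum of the
positive parts of the differences. -/
lemma sum_posPart_sortedTuple_sub_le {m : ℕ} (u v : Fin m → ℝ) :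
    ∑ a, (sortedTuple u a - sortedTuple v a)⁺ ≤ ∑ a, (u a - v a)⁺ := by
  have hu := sortedTuple_mono (le_sup_left : u ≤ u ⊔ v)
  have hv := sortedTuple_mono (le_sup_right : v ≤ u ⊔ v)
  calc ∑ a, (sortedTuple u a - sortedTuple v a)⁺
      ≤ ∑ a, (sortedTuple (u ⊔ v) a - sortedTuple v a) :=
        sum_le_sum fun a _ => sup_le (sub_le_sub_right (hu a) _) (sub_nonneg.2 (hv a))
    _ = ∑ a, ((u ⊔ v) a - v a) := by simp only [sum_sub_distrib, sum_sortedTuple]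
    _ = ∑ a, (u a - v a)⁺ := by
        refine sum_congr rfl fun a _ => ?_
        rw [posPart_def, Pi.sup_apply, ← sub_self (v a), ← max_sub_sub_right]

lemma sub_le_sum_of_forall_sub_succ_le {m : ℕ} {h D : Fin m → ℝ} (hD : ∀ a, 0 ≤ D a)
    (hstep : ∀ (a : Fin m) (ha : (a : ℕ) + 1 < m), h a - h ⟨a + 1, ha⟩ ≤ D a)
    {j k : Fin m} (hjk : j ≤ k) : h j - h k ≤ ∑ a, D a := by
  have key : ∀ l : ℕ, (j : ℕ) ≤ l → ∀ hl : l < m,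
      h j - h ⟨l, hl⟩ ≤ ∑ a with (a : Fin m).val < l, D a := by
    intro l hjl
    induction l, hjl using Nat.le_induction with
    | base => intro hl; simpa using sum_nonneg fun a _ => hD a
    | succ l _ ih =>
      intro hl
      have hl' : l < m := by omega
      have hins : ({a : Fin m | a.val < l + 1} : Finset (Fin m)) =
          insert ⟨l, hl'⟩ ({a : Fin m | a.val < l} : Finset (Fin m)) := by
        ext a
        simp only [mem_filter, mem_univ, true_and, mem_insert, Fin.ext_iff]
        omega
      rw [hins, sum_insert (by simp)]
      linarith [ih hl', hstep ⟨l, hl'⟩ hl]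
  exact (key k hjk k.2).trans
    (sum_le_sum_of_subset_of_nonneg (filter_subset _ _) fun a _ _ => hD a)

lemma abs_sortedTuple_sub_le {m : ℕ} {h D : Fin m → ℝ} (hD : ∀ a, 0 ≤ D a)
    (hstep : ∀ (a : Fin m) (ha : (a : ℕ) + 1 < m), h a - h ⟨a + 1, ha⟩ ≤ D a) (k : Fin m) :
    |sortedTuple h k - h k| ≤ ∑ a, D a := by
  rw [abs_le]
  constructor
  · have : h k - ∑ a, D a ≤ sortedTuple h k :=
      le_sortedTuple_of_card (s := Ici k) (by simp; omega) fun j hj => by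
        linarith [sub_le_sum_of_forall_sub_succ_le hD hstep (mem_Ici.1 hj)]
    linarith
  · have : sortedTuple h k ≤ h k + ∑ a, D a :=
      sortedTuple_le_of_card (s := Iic k) (by simp) fun j hj => by
        linarith [sub_le_sum_of_forall_sub_succ_le hD hstep (mem_Iic.1 hj)]
    linarith

/-- `f` sorted along every axis-parallel line in direction `i`. -/
noncomputable def sortAlong {m n : ℕ} (i : Fin n) (f : (Fin n → Fin m) → ℝ)
    (x : Fin n → Fin m) : ℝ :=
  sortedTuple (fun a => f (Function.update x i a)) (x i)

lemma sortAlong_update {m n : ℕ} (i : Fin n) (f : (Fin n → Fin m) → ℝ)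
    (x : Fin n → Fin m) (a : Fin m) :
    sortAlong i f (Function.update x i a) = sortedTuple (fun b => f (Function.update x i b)) a := by
  simp [sortAlong]

/-- The total decrease of `f` along the edges of the grid in direction `i`. -/
noncomputable def totalDecrease {m n : ℕ} (i : Fin n) (f : (Fin n → Fin m) → ℝ) : ℝ :=
  ∑ x, (dPartial i f x)⁻

lemma totalDecrease_nonneg {m n : ℕ} (i : Fin n) (f : (Fin n → Fin m) → ℝ) :
    0 ≤ totalDecrease i f :=
  sum_nonneg fun _ _ => negPart_nonneg _

lemma sum_sum_update {m n : ℕ} (i : Fin n) (G : (Fin n → Fin m) → ℝ) :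
    ∑ x, ∑ a, G (Function.update x i a) = m * ∑ x, G x := by
  calc ∑ x, ∑ a, G (Function.update x i a)
      = ∑ p : (Fin n → Fin m) × Fin m, G (Function.update p.1 i p.2) :=
        (Fintype.sum_prod_type fun p : (Fin n → Fin m) × Fin m => G (Function.update p.1 i p.2)).symm
    _ = ∑ p : (Fin n → Fin m) × Fin m, G p.1 := by
        refine sum_nbij' (fun p => (Function.update p.1 i p.2, p.1 i))
          (fun p => (Function.update p.1 i p.2, p.1 i)) ?_ ?_ ?_ ?_ ?_ <;> simp
    _ = m * ∑ x, G x := by simp [Fintype.sum_prod_type, mul_sum]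

lemma sub_succ_le_negPart_dPartial {m n : ℕ} (i : Fin n) (f : (Fin n → Fin m) → ℝ)
    (x : Fin n → Fin m) (a : Fin m) (ha : (a : ℕ) + 1 < m) :
    f (Function.update x i a) - f (Function.update x i ⟨a + 1, ha⟩) ≤
      (dPartial i f (Function.update x i a))⁻ := by
  have h := neg_le_negPart (dPartial i f (Function.update x i a))
  simpa [dPartial, ha] using h

lemma sum_abs_sortAlong_sub_le {m n : ℕ} (i : Fin n) (f : (Fin n → Fin m) → ℝ) :
    ∑ x, |sortAlong i f x - f x| ≤ m * totalDecrease i f := by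
  rw [totalDecrease, ← sum_sum_update i]
  refine sum_le_sum fun x _ => ?_
  have h := abs_sortedTuple_sub_le (h := fun a => f (Function.update x i a))
    (fun a => negPart_nonneg (dPartial i f (Function.update x i a)))
    (sub_succ_le_negPart_dPartial i f x) (x i)
  simpa [sortAlong] using h

lemma totalDecrease_sortAlong_self {m n : ℕ} (i : Fin n) (f : (Fin n → Fin m) → ℝ) :
    totalDecrease i (sortAlong i f) = 0 := by
  refine sum_eq_zero fun x _ => negPart_eq_zero.2 ?_
  unfold dPartial
  split_ifs with h
  · rw [sortAlong_update, sortAlong, sub_nonneg]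
    exact sortedTuple_monotone _ (Fin.mk_le_mk.2 (Nat.le_succ _))
  · exact le_rfl

lemma totalDecrease_sortAlong_le {m n : ℕ} {i j : Fin n} (hij : i ≠ j)
    (f : (Fin n → Fin m) → ℝ) : totalDecrease j (sortAlong i f) ≤ totalDecrease j f := by
  rcases Nat.eq_zero_or_pos m with rfl | hm
  · have : IsEmpty (Fin n → Fin 0) := ⟨fun x => (x i).elim0⟩
    simp [totalDecrease]
  have hm' : (0 : ℝ) < m := by exact_mod_cast hm
  refine le_of_mul_le_mul_left ?_ hm'
  simp only [totalDecrease]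
  rw [← sum_sum_update i, ← sum_sum_update i]
  refine sum_le_sum fun x _ => ?_
  by_cases h : (x j : ℕ) + 1 < m
  · have hx : ∀ (g : (Fin n → Fin m) → ℝ) (a : Fin m), (dPartial j g (Function.update x i a))⁻ =
        (g (Function.update x i a) -
          g (Function.update (Function.update x j ⟨x j + 1, h⟩) i a))⁺ := by
      intro g a
      rw [← neg_sub, posPart_neg]
      simp [dPartial, Function.update_of_ne hij.symm, h, Function.update_comm hij]
    simp only [hx, sortAlong_update]
    exact sum_posPart_sortedTuple_sub_le _ _
  · simp [dPartial, Function.update_of_ne hij.symm, h]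

lemma monotone_of_totalDecrease_eq_zero {m n : ℕ} {g : (Fin n → Fin m) → ℝ}
    (hg : ∀ i, totalDecrease i g = 0) : Monotone g := by
  have hneg : ∀ i x, (dPartial i g x)⁻ = 0 := fun i x =>
    (sum_eq_zero_iff_of_nonneg fun x _ => negPart_nonneg (dPartial i g x)).1 (hg i) x (mem_univ x)
  have hline : ∀ x i (b : Fin m), x i ≤ b → g x ≤ g (Function.update x i b) := by
    intro x i b hb
    have h := sub_le_sum_of_forall_sub_succ_le (h := fun a => g (Function.update x i a))
      (fun a => negPart_nonneg (dPartial i g (Function.update x i a)))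
      (sub_succ_le_negPart_dPartial i g x) hb
    simpa [hneg] using h
  intro x y hxy
  have hs : ∀ s : Finset (Fin n), g x ≤ g (s.piecewise y x) := by
    intro s
    induction s using Finset.induction_on with
    | empty => simp
    | insert j s hj ih =>
      rw [piecewise_insert]
      exact ih.trans (hline _ j _ (by simpa [hj] using hxy j))
  simpa using hs univ

lemma exists_totalDecrease_eq_zero {m n : ℕ} (f : (Fin n → Fin m) → ℝ) (s : Finset (Fin n)) :
    ∃ g : (Fin n → Fin m) → ℝ, (∀ i ∈ s, totalDecrease i g = 0) ∧
      (∀ j, totalDecrease j g ≤ totalDecrease j f) ∧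
      ∑ x, |f x - g x| ≤ m * ∑ i ∈ s, totalDecrease i f := by
  induction s using Finset.induction_on with
  | empty => exact ⟨f, by simp, fun _ => le_rfl, by simp⟩
  | insert i s hi ih =>
    obtain ⟨g, hzero, hle, hdist⟩ := ih
    refine ⟨sortAlong i g, fun j hj => ?_, fun j => ?_, ?_⟩
    · rcases eq_or_ne i j with rfl | hij
      · exact totalDecrease_sortAlong_self i g
      · have hjs : j ∈ s := (mem_insert.1 hj).resolve_left hij.symm
        exact le_antisymm ((totalDecrease_sortAlong_le hij g).trans (hzero j hjs).le)
          (totalDecrease_nonneg _ _)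
    · rcases eq_or_ne i j with rfl | hij
      · exact (totalDecrease_sortAlong_self i g).trans_le (totalDecrease_nonneg _ _)
      · exact (totalDecrease_sortAlong_le hij g).trans (hle j)
    · calc ∑ x, |f x - sortAlong i g x|
          ≤ ∑ x, (|f x - g x| + |sortAlong i g x - g x|) :=
            sum_le_sum fun x _ => by
              rw [abs_sub_comm (sortAlong i g x)]; exact abs_sub_le _ _ _
        _ ≤ m * ∑ i ∈ s, totalDecrease i f + m * totalDecrease i f := by
            rw [sum_add_distrib]
            exact add_le_add hdist ((sum_abs_sortAlong_sub_le i g).trans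
              (mul_le_mul_of_nonneg_left (hle i) m.cast_nonneg))
        _ = m * ∑ j ∈ insert i s, totalDecrease j f := by rw [sum_insert hi]; ring

/-- Directed Poincaré inequality in `L¹` on the hypergrid. -/
lemma exists_monotone_sum_abs_sub_le {m n : ℕ} (f : (Fin n → Fin m) → ℝ) :
    ∃ g : (Fin n → Fin m) → ℝ, Monotone g ∧
      ∑ x, |f x - g x| ≤ m * ∑ i, totalDecrease i f := by
  obtain ⟨g, hzero, -, hdist⟩ := exists_totalDecrease_eq_zero f univ
  exact ⟨g, monotone_of_totalDecrease_eq_zero fun i => hzero i (mem_univ i), hdist⟩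

lemma totalDecrease_le_mul_ncard {m n : ℕ} {L : ℝ} {f : (Fin n → Fin m) → ℝ}
    (hf : ∀ x y : Fin n → Fin m,
      |f x - f y| ≤ L * ∑ i, |((x i : ℕ) : ℝ) - ((y i : ℕ) : ℝ)|) (i : Fin n) :
    totalDecrease i f ≤ L * ({x : Fin n → Fin m | dPartial i f x < 0}.ncard : ℝ) := by
  classical
  have hcard : ({x : Fin n → Fin m | dPartial i f x < 0}.ncard : ℝ) =
      ∑ x, if dPartial i f x < 0 then (1 : ℝ) else 0 := by
    rw [Set.ncard_eq_toFinset_card']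
    simp
  rw [hcard, mul_sum, totalDecrease]
  refine sum_le_sum fun x _ => ?_
  split_ifs with hx
  · rw [negPart_of_nonpos hx.le]
    unfold dPartial at hx ⊢
    split_ifs at hx ⊢ with h
    · have hL := hf x (Function.update x i ⟨(x i : ℕ) + 1, h⟩)
      have hsum : ∑ k, |((x k : ℕ) : ℝ) -
          ((Function.update x i ⟨(x i : ℕ) + 1, h⟩ k : Fin m) : ℕ)| = 1 := by
        rw [sum_eq_single i (fun k _ hk => by simp [Function.update_of_ne hk]) (by simp)]
        simp
      rw [hsum] at hL
      rw [neg_sub]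
      exact (le_abs_self _).trans hL
    · exact absurd hx (lt_irrefl 0)
  · simp [negPart_eq_zero.2 (not_lt.1 hx)]

/-- **Far-from-monotone Lipschitz functions on the hypergrid have many negative partial
derivatives.** If `f : [m]ⁿ → ℝ` is `(ℓ¹, L)`-Lipschitz and its `L¹` distance to
monotonicity (under the uniform measure) exceeds `ε`, then the sets
`Sᵢ = {x : ∂ᵢ f(x) < 0}` satisfy `Σᵢ μ(Sᵢ) > ε / (2 m L)`. -/
theorem sum_measure_negative_partials_hypergrid {m n : ℕ} (L ε : ℝ) (hL : 0 < L)
    (hε : 0 < ε) (f : (Fin n → Fin m) → ℝ)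
    (hf : ∀ x y : Fin n → Fin m,
      |f x - f y| ≤ L * ∑ i, |((x i : ℕ) : ℝ) - ((y i : ℕ) : ℝ)|)
    (hd : ε < sInf {d : ℝ | ∃ g : (Fin n → Fin m) → ℝ, Monotone g ∧
      d = (1 / (m ^ n : ℝ)) * ∑ x, |f x - g x|}) :
    ε / (2 * m * L) <
      ∑ i : Fin n, ({x : Fin n → Fin m | dPartial i f x < 0}.ncard : ℝ) / (m ^ n : ℝ) := by
  obtain ⟨g, hg, hdist⟩ := exists_monotone_sum_abs_sub_le f
  have hbound : ε < (1 / (m ^ n : ℝ)) * ∑ x, |f x - g x| := by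
    refine hd.trans_le (csInf_le ⟨0, ?_⟩ ⟨g, hg, rfl⟩)
    rintro d ⟨g', -, rfl⟩
    positivity
  have hsum : ∑ i, totalDecrease i f ≤
      L * ∑ i : Fin n, ({x : Fin n → Fin m | dPartial i f x < 0}.ncard : ℝ) := by
    rw [mul_sum]
    exact sum_le_sum fun i _ => totalDecrease_le_mul_ncard hf i
  rw [← sum_div]
  set S := ∑ i : Fin n, ({x : Fin n → Fin m | dPartial i f x < 0}.ncard : ℝ)
  have hε' : ε < m * L * (S / (m ^ n : ℝ)) :=
    calc ε < (1 / (m ^ n : ℝ)) * ∑ x, |f x - g x| := hbound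
      _ ≤ (1 / (m ^ n : ℝ)) * (m * (L * S)) := by gcongr; exact hdist.trans (by gcongr)
      _ = m * L * (S / (m ^ n : ℝ)) := by ring
  have hm : (0 : ℝ) < m := by
    refine m.cast_nonneg.lt_of_ne fun h => ?_
    rw [← h] at hε'
    linarith
  rw [div_lt_iff₀ (by positivity)]
  nlinarith
end

section
/- Let f : [m] → ℝ satisfy |f(x+1) − f(x)| ≤ L for all x ∈ [m−1], and let f* : [m] → ℝ be its monotone rearrangement (the sorted sequence of the values of f). Then |f*(x+1) − f*(x)| ≤ L for all x ∈ [m−1], i.e., the monotone rearrangement has Lipschitz constant at most that of f. -/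
/-- The sorted (non-decreasing) rearrangement of a tuple of reals: the monotone
rearrangement of `f : [m] → ℝ`. -/
noncomputable def sortTuple {m : ℕ} (f : Fin m → ℝ) : Fin m → ℝ := f ∘ Tuple.sort f

/-- A tuple whose consecutive entries differ by less than the length of a gap `(a, b)` in its
values stays on one side of that gap. -/
theorem le_iff_le_of_gap {m : ℕ} {f : Fin m → ℝ} {a b : ℝ}
    (hf : ∀ (x : Fin m) (h : (x : ℕ) + 1 < m), |f ⟨(x : ℕ) + 1, h⟩ - f x| < b - a)
    (hgap : ∀ i, f i ≤ a ∨ b ≤ f i) (i j : Fin m) : f i ≤ a ↔ f j ≤ a := by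
  have hzero : ∀ (n : ℕ) (hn : n < m), f ⟨n, hn⟩ ≤ a ↔ f ⟨0, by omega⟩ ≤ a := by
    intro n
    induction n with
    | zero => exact fun _ => Iff.rfl
    | succ k ih =>
      intro hn
      rw [← ih (by omega)]
      have hstep := abs_lt.mp (hf ⟨k, by omega⟩ hn)
      have hpos := (abs_nonneg _).trans_lt (hf ⟨k, by omega⟩ hn)
      dsimp only at hstep
      constructor <;> intro hle
      · rcases hgap ⟨k, by omega⟩ with h | h
        · exact h
        · linarith
      · rcases hgap ⟨k + 1, hn⟩ with h | h
        · exact h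
        · linarith
  exact (hzero i i.2).trans (hzero j j.2).symm

theorem monotone_sortTuple {m : ℕ} (f : Fin m → ℝ) : Monotone (sortTuple f) :=
  Tuple.monotone_sort f

/-- No value of `f` lies strictly between two consecutive values of its sorted rearrangement. -/
theorem le_sortTuple_or_sortTuple_succ_le {m : ℕ} (f : Fin m → ℝ) (x : Fin m)
    (h : (x : ℕ) + 1 < m) (i : Fin m) :
    f i ≤ sortTuple f x ∨ sortTuple f ⟨(x : ℕ) + 1, h⟩ ≤ f i := by
  obtain ⟨k, rfl⟩ := (Tuple.sort f).surjective i
  rcases le_or_gt k x with hk | hk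
  · exact Or.inl (monotone_sortTuple f hk)
  · exact Or.inr (monotone_sortTuple f (Fin.mk_le_of_le_val (Nat.succ_le_of_lt hk)))

/-- **The monotone (sorted) rearrangement has Lipschitz constant at most that of `f`:**
if `|f(x+1) − f(x)| ≤ L` for all `x ∈ [m−1]`, then the same holds for the sorted
sequence `f*`. -/
theorem sorted_rearrangement_lipschitz {m : ℕ} (L : ℝ) (f : Fin m → ℝ)
    (hf : ∀ (x : Fin m) (h : (x : ℕ) + 1 < m), |f ⟨(x : ℕ) + 1, h⟩ - f x| ≤ L) :
    ∀ (x : Fin m) (h : (x : ℕ) + 1 < m),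
      |sortTuple f ⟨(x : ℕ) + 1, h⟩ - sortTuple f x| ≤ L := by
  intro x h
  have hle : sortTuple f x ≤ sortTuple f ⟨(x : ℕ) + 1, h⟩ :=
    monotone_sortTuple f (Fin.mk_le_of_le_val (Nat.le_succ _))
  rw [abs_of_nonneg (sub_nonneg.mpr hle)]
  by_contra! hlt
  have hiff := le_iff_le_of_gap (fun y hy => (hf y hy).trans_lt hlt)
    (le_sortTuple_or_sortTuple_succ_le f x h)
    (Tuple.sort f x) (Tuple.sort f ⟨(x : ℕ) + 1, h⟩)
  have hge : sortTuple f ⟨(x : ℕ) + 1, h⟩ ≤ sortTuple f x := hiff.mp le_rfl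
  linarith [(abs_nonneg _).trans (hf x h)]
end
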